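/- arXiv:1103.3246 — 11 statements merged into one kernel-verified Lean document; each statement's English description precedes it below -/
import Mathlib

section
/- Let S be a semigroup and n a positive natural number. If S satisfies the identities x² = x^{n+2} and xyx = (xy)^{n+1}x for all x, y in S, then S is cyclically regular: every element of the form a·x·a (with a, x ∈ S) and every element of the form a·a is regular. -/
/-- An element `b` of a semigroup is regular if `b = b * y * b` for some `y`. -/
def IsRegularElem {S : Type*} [Semigroup S] (b : S) : Prop := ∃ y, b = b * y * b

/-- A semigroup is cyclically regular if every cyclic element (an element of the
form `a * x * a` with `x ∈ S`, or `a * a`) is regular. -/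
def CyclicallyRegular (S : Type*) [Semigroup S] : Prop :=
  (∀ a x : S, IsRegularElem (a * x * a)) ∧ ∀ a : S, IsRegularElem (a * a)

/-- Powers in a semigroup: `spow x n = x ^ (n + 1)`. -/
def spow {S : Type*} [Semigroup S] (x : S) : ℕ → S
  | 0 => x
  | n + 1 => spow x n * x

theorem spow_mul_spow {S : Type*} [Semigroup S] (t : S) (a b : ℕ) :
    spow t a * spow t b = spow t (a + b + 1) := by
  induction b with
  | zero => rfl
  | succ b ih =>
    change spow t a * (spow t b * t) = spow t (a + b + 1) * t
    rw [← mul_assoc, ih]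

theorem spow_add_mul_of_mul_eq {S : Type*} [Semigroup S] {t x : S} {n : ℕ}
    (h : t * x = spow t n * x) (k : ℕ) : spow t (k + n) * x = spow t k * x := by
  cases k with
  | zero => rw [Nat.zero_add]; exact h.symm
  | succ j =>
    rw [show j + 1 + n = j + n + 1 by omega, ← spow_mul_spow, mul_assoc, ← h, ← mul_assoc]
    rfl

theorem mul_eq_spow_three_mul {S : Type*} [Semigroup S] {t x : S} {n : ℕ}
    (h : t * x = spow t n * x) : t * x = spow t (n + n + n) * x := by
  rw [spow_add_mul_of_mul_eq h, spow_add_mul_of_mul_eq h, h]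

theorem spow_three_mul {S : Type*} [Semigroup S] (t : S) {n : ℕ} (hn : 0 < n) :
    spow t (n + n + n) = t * t * spow t (3 * n - 3) * t := by
  change _ = spow t 1 * spow t (3 * n - 3) * spow t 0
  rw [spow_mul_spow, spow_mul_spow]
  congr 1
  omega

/-- If a semigroup satisfies the identities `x² = x^(n+2)` and
`x·y·x = (x·y)^(n+1)·x` for some positive `n`, then it is cyclically regular. -/
theorem stmt_0 {S : Type*} [Semigroup S] (n : ℕ) (hn : 0 < n)
    (h1 : ∀ x : S, x * x = spow x (n + 1))
    (h2 : ∀ x y : S, x * y * x = spow (x * y) n * x) :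
    CyclicallyRegular S := by
  constructor
  · intro a x
    refine ⟨x * spow (a * x) (3 * n - 3), ?_⟩
    conv_lhs => rw [mul_eq_spow_three_mul (h2 a x), spow_three_mul _ hn]
    simp only [mul_assoc]
  · intro a
    have h : a * a = spow a n * a := h1 a
    refine ⟨spow a (3 * n - 3), ?_⟩
    conv_lhs => rw [mul_eq_spow_three_mul h, spow_three_mul _ hn]
    simp only [mul_assoc]
end

section
/- Let S be a semigroup in which the product of any two idempotents is again an idempotent. Then S is regularly closed: for any regular elements a, b of S, the product a·b is regular; in fact if a = a·x·a and b = b·y·b, then a·b = a·b·(y·x)·a·b. -/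
/-- If in a semigroup `S` the product of any two idempotents is idempotent, then the
product of regular elements is regular; explicitly, if `a = a*x*a` and `b = b*y*b`
then `a*b = a*b*(y*x)*(a*b)`. -/
theorem stmt_1 {S : Type*} [Semigroup S]
    (h : ∀ e f : S, e * e = e → f * f = f → (e * f) * (e * f) = e * f) :
    ∀ a b x y : S, a = a * x * a → b = b * y * b →
      a * b = (a * b) * (y * x) * (a * b) := by
  intro a b x y ha hb
  have hxa : (x * a) * (x * a) = x * a := by
    rw [mul_assoc, ← mul_assoc a x a, ← ha]
  have hby : (b * y) * (b * y) = b * y := by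
    rw [← mul_assoc, ← hb]
  calc
    a * b = (a * x * a) * (b * y * b) := by rw [← ha, ← hb]
    _ = a * ((x * a) * (b * y)) * b := by simp only [mul_assoc]
    _ = a * ((x * a) * (b * y) * ((x * a) * (b * y))) * b := by rw [h _ _ hxa hby]
    _ = (a * x * a) * b * (y * x) * (a * (b * y * b)) := by simp only [mul_assoc]
    _ = (a * b) * (y * x) * (a * b) := by rw [← ha, ← hb]
end

section
/- Let S be a cyclically regular semigroup, let a, e, f, w ∈ S, where e and f are idempotents belonging to the principal ideal I(a) generated by a, and suppose w = e·w = w·f. Then w is a regular element of S. -/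
/-- `b` belongs to the principal ideal `I(a) = S¹ a S¹` generated by `a`. -/
def InPrincipalIdeal {S : Type*} [Semigroup S] (a b : S) : Prop :=
  b = a ∨ (∃ s, b = s * a) ∨ (∃ s, b = a * s) ∨ ∃ s t, b = s * a * t

/-- An idempotent in the principal ideal generated by `a` has a two-sided factorization through
`a`, even without adjoining an identity. -/
theorem InPrincipalIdeal.exists_eq_mul_mul {S : Type*} [Semigroup S] {a e : S}
    (h : InPrincipalIdeal a e) (he : e * e = e) : ∃ s t, s * a * t = e := by
  rcases h with rfl | ⟨s, hs⟩ | ⟨t, ht⟩ | ⟨s, t, hst⟩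
  · exact ⟨e, e, by rw [he, he]⟩
  · exact ⟨s, e, by rw [← hs, he]⟩
  · exact ⟨e, t, by rw [mul_assoc, ← ht, he]⟩
  · exact ⟨s, t, hst.symm⟩

/-- In a cyclically regular semigroup, if idempotents `e, f` lie in the principal
ideal generated by `a` and `w = e*w = w*f`, then `w` is regular. -/
theorem stmt_2 {S : Type*} [Semigroup S] (hS : CyclicallyRegular S)
    (a e f w : S) (he : e * e = e) (hf : f * f = f)
    (hea : InPrincipalIdeal a e) (hfa : InPrincipalIdeal a f)
    (hw1 : w = e * w) (hw2 : w = w * f) :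
    IsRegularElem w := by
  obtain ⟨s, t, hst⟩ := hea.exists_eq_mul_mul he
  obtain ⟨u, v, huv⟩ := hfa.exists_eq_mul_mul hf
  obtain ⟨y, hy⟩ := hS.1 a (t * w * u)
  refine ⟨u * a * y * a * t, ?_⟩
  calc
    w = e * w * f := by rw [← hw1, ← hw2]
    _ = s * (a * (t * w * u) * a) * v := by simp only [← hst, ← huv, mul_assoc]
    _ = s * (a * (t * w * u) * a * y * (a * (t * w * u) * a)) * v := by rw [← hy]
    _ = e * w * (u * a * y * a * t) * (w * f) := by simp only [← hst, ← huv, mul_assoc]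
    _ = w * (u * a * y * a * t) * w := by rw [← hw1, ← hw2]
end

section
/- Let S be a cyclically regular semigroup and a ∈ S. Then the principal ideal I(a) is regularly closed: if b and c are elements of I(a) that are regular within I(a) (i.e., b = b·x·b and c = c·y·c for some x, y ∈ I(a)), then there exists z ∈ I(a) with b·c = b·c·z·b·c. -/
/-- Multiplying an element of `I(a)` on both sides gives an element of `S * a * S`. -/
theorem InPrincipalIdeal.exists_mul_mul {S : Type*} [Semigroup S] {a b : S}
    (hb : InPrincipalIdeal a b) (u v : S) : ∃ s t, u * b * v = s * a * t := by
  rcases hb with rfl | ⟨s, rfl⟩ | ⟨t, rfl⟩ | ⟨s, t, rfl⟩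
  · exact ⟨u, v, rfl⟩
  · exact ⟨u * s, v, by simp only [mul_assoc]⟩
  · exact ⟨u, t * v, by simp only [mul_assoc]⟩
  · exact ⟨u * s, t * v, by simp only [mul_assoc]⟩

/-- An idempotent `e ∈ S * a * S` factors as `s * a * t` with `e * s = s` and `t * e = t`. -/
theorem IsIdempotentElem.exists_factorization {S : Type*} [Semigroup S] {a e : S}
    (he : IsIdempotentElem e) (h : ∃ s t, e = s * a * t) :
    ∃ s t, s * a * t = e ∧ e * s = s ∧ t * e = t := by
  obtain ⟨s, t, hst⟩ := h
  refine ⟨e * s, t * e, ?_, ?_, ?_⟩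
  · calc e * s * a * (t * e) = e * (s * a * t) * e := by simp only [mul_assoc]
      _ = e := by rw [← hst, he.eq, he.eq]
  · rw [← mul_assoc, he.eq]
  · rw [mul_assoc, he.eq]

/-- In a cyclically regular semigroup, the product of two idempotents of `S * a * S` is regular. -/
theorem CyclicallyRegular.isRegularElem_mul {S : Type*} [Semigroup S]
    (hS : CyclicallyRegular S) {a e f : S} (he : IsIdempotentElem e) (hf : IsIdempotentElem f)
    (hea : ∃ s t, e = s * a * t) (hfa : ∃ s t, f = s * a * t) : IsRegularElem (e * f) := by
  obtain ⟨s, t, hst, -, hte⟩ := he.exists_factorization hea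
  obtain ⟨p, q, hpq, hfp, -⟩ := hf.exists_factorization hfa
  obtain ⟨z, hz⟩ := hS.1 a (t * p)
  have hl : s * (a * (t * p) * a) = e * f * (p * a) := by
    calc s * (a * (t * p) * a) = s * a * t * p * a := by simp only [mul_assoc]
      _ = e * (f * p) * a := by rw [hst, hfp]
      _ = e * f * (p * a) := by simp only [mul_assoc]
  have hr : a * (t * p) * a * q = a * t * (e * f) := by
    calc a * (t * p) * a * q = a * t * (p * a * q) := by simp only [mul_assoc]
      _ = a * (t * e) * f := by rw [hpq, hte]
      _ = a * t * (e * f) := by simp only [mul_assoc]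
  refine ⟨p * a * z * (a * t), ?_⟩
  calc e * f = s * (a * (t * p) * a) * q := by
        rw [← hst, ← hpq]; simp only [mul_assoc]
    _ = s * (a * (t * p) * a * z * (a * (t * p) * a)) * q := by rw [← hz]
    _ = s * (a * (t * p) * a) * z * (a * (t * p) * a * q) := by simp only [mul_assoc]
    _ = e * f * (p * a) * z * (a * t * (e * f)) := by rw [hl, hr]
    _ = e * f * (p * a * z * (a * t)) * (e * f) := by simp only [mul_assoc]

/-- In a cyclically regular semigroup, every principal ideal is regularly closed:
if `b, c ∈ I(a)` are regular within `I(a)`, then so is `b * c`. -/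
theorem stmt_3 {S : Type*} [Semigroup S] (hS : CyclicallyRegular S) (a : S)
    (b c : S) (hb : InPrincipalIdeal a b) (hc : InPrincipalIdeal a c)
    (hbr : ∃ x, InPrincipalIdeal a x ∧ b = b * x * b)
    (hcr : ∃ y, InPrincipalIdeal a y ∧ c = c * y * c) :
    ∃ z, InPrincipalIdeal a z ∧ b * c = (b * c) * z * (b * c) := by
  obtain ⟨x, -, hx⟩ := hbr
  obtain ⟨y, -, hy⟩ := hcr
  have he : IsIdempotentElem (x * b) := by
    change x * b * (x * b) = x * b
    rw [mul_assoc, ← mul_assoc b, ← hx]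
  have hf : IsIdempotentElem (c * y) := by
    change c * y * (c * y) = c * y
    rw [← mul_assoc, ← hy]
  obtain ⟨z, hz⟩ := hS.isRegularElem_mul (a := a) he hf
    (by rw [← he.eq]; exact hb.exists_mul_mul x (x * b))
    (by rw [← hf.eq, ← mul_assoc]; exact hc.exists_mul_mul (c * y) y)
  have key : b * c = b * c * (y * z * x) * (b * c) := by
    calc b * c = b * x * b * (c * y * c) := by rw [← hx, ← hy]
      _ = b * (x * b * (c * y)) * c := by simp only [mul_assoc]
      _ = b * (x * b * (c * y) * z * (x * b * (c * y))) * c := by rw [← hz]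
      _ = b * x * b * c * (y * z * x) * (b * (c * y * c)) := by simp only [mul_assoc]
      _ = b * c * (y * z * x) * (b * c) := by rw [← hx, ← hy]
  generalize y * z * x = w at key
  refine ⟨w * (b * c) * w, ?_, ?_⟩
  · obtain ⟨s, t, h⟩ := hb.exists_mul_mul w (c * w)
    exact Or.inr (Or.inr (Or.inr ⟨s, t, by rw [← h]; simp only [mul_assoc]⟩))
  · calc b * c = b * c * w * (b * c) := key
      _ = b * c * w * (b * c * w * (b * c)) := congrArg (b * c * w * ·) key
      _ = b * c * (w * (b * c) * w) * (b * c) := by simp only [mul_assoc]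
end

section
/- Let S be a cyclically regular semigroup, let w be a regular word over an alphabet X, and let f : X → S be any assignment of values to letters. Then the value of w in S under f is a regular element of S. -/
/-- The contiguous factor of `u` occupying positions `[p, q)` is a cyclic subword
(a cycle): its length `q - p` is at least 2 and its first and last letters coincide. -/
def IsCycleAt {X : Type*} (u : List X) (p q : ℕ) : Prop :=
  p + 2 ≤ q ∧ q ≤ u.length ∧ u[p]? = u[q - 1]?

/-- A word is regular if its length is greater than 1 and every two consecutive
letters (occurrences at positions `i`, `i+1`) lie in a common cyclic subword. -/
def RegularWord {X : Type*} (u : List X) : Prop :=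
  1 < u.length ∧ ∀ i, i + 1 < u.length →
    ∃ p q, p ≤ i ∧ i + 1 < q ∧ IsCycleAt u p q

/-- The value of the nonempty word `x :: w` in a semigroup under the assignment `f`. -/
def evalWord {X S : Type*} [Semigroup S] (f : X → S) (x : X) (w : List X) : S :=
  w.foldl (fun s c => s * f c) (f x)

/-- If `s * t` and `t * r` are regular in a cyclically regular semigroup, so is `s * t * r`. -/
theorem CyclicallyRegular.isRegularElem_mul_mul {S : Type*} [Semigroup S]
    (hS : CyclicallyRegular S) {s t r : S} (hst : IsRegularElem (s * t))
    (htr : IsRegularElem (t * r)) : IsRegularElem (s * t * r) := by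
  obtain ⟨c, hc⟩ := hst
  obtain ⟨d, hd⟩ := htr
  obtain ⟨e, he⟩ := hS.1 t (c * s * t * r * d)
  refine ⟨d * t * e * t * c, ?_⟩
  have key : s * t * r = s * (t * (c * s * t * r * d) * t) * r := by
    calc s * t * r = s * (t * r) := mul_assoc ..
      _ = s * (t * r * d * (t * r)) := by rw [← hd]
      _ = s * t * (r * d * t * r) := by simp only [mul_assoc]
      _ = s * t * c * (s * t) * (r * d * t * r) := by rw [← hc]
      _ = _ := by simp only [mul_assoc]
  have hleft : s * t * r * d * t = s * (t * (c * s * t * r * d) * t) := by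
    calc s * t * r * d * t = s * t * (r * d * t) := by simp only [mul_assoc]
      _ = s * t * c * (s * t) * (r * d * t) := by rw [← hc]
      _ = _ := by simp only [mul_assoc]
  have hright : t * c * (s * t * r) = t * (c * s * t * r * d) * t * r := by
    calc t * c * (s * t * r) = t * c * s * (t * r) := by simp only [mul_assoc]
      _ = t * c * s * (t * r * d * (t * r)) := by rw [← hd]
      _ = _ := by simp only [mul_assoc]
  calc s * t * r = s * (t * (c * s * t * r * d) * t) * r := key
    _ = s * (t * (c * s * t * r * d) * t * e * (t * (c * s * t * r * d) * t)) * r := by rw [← he]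
    _ = s * (t * (c * s * t * r * d) * t) * e * (t * (c * s * t * r * d) * t * r) := by
      simp only [mul_assoc]
    _ = s * t * r * d * t * e * (t * c * (s * t * r)) := by rw [← hleft, ← hright]
    _ = _ := by simp only [mul_assoc]

/-- The product `g p * g (p + 1) * ⋯ * g (p + k)`. -/
def segmentProd {S : Type*} [Semigroup S] (g : ℕ → S) (p : ℕ) : ℕ → S
  | 0 => g p
  | k + 1 => segmentProd g p k * g (p + k + 1)

theorem segmentProd_mul_segmentProd {S : Type*} [Semigroup S] (g : ℕ → S) (p k l : ℕ) :
    segmentProd g p k * segmentProd g (p + k + 1) l = segmentProd g p (k + l + 1) := by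
  induction l with
  | zero => rfl
  | succ l ih =>
    rw [segmentProd, ← mul_assoc, ih, show k + (l + 1) + 1 = k + l + 1 + 1 by omega]
    simp only [segmentProd]
    congr 2
    omega

theorem CyclicallyRegular.isRegularElem_segmentProd_of_eq {S : Type*} [Semigroup S]
    (hS : CyclicallyRegular S) (g : ℕ → S) {p k : ℕ} (hk : 0 < k) (h : g p = g (p + k)) :
    IsRegularElem (segmentProd g p k) := by
  obtain _ | _ | k := k
  · omega
  · simpa [segmentProd, ← h] using hS.2 (g p)
  · have := segmentProd_mul_segmentProd g p 0 k
    rw [Nat.zero_add] at this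
    rw [segmentProd, ← this, show p + (k + 1) + 1 = p + (k + 1 + 1) from rfl, ← h]
    exact hS.1 _ _

/-- A product of consecutive values of `g` is regular as soon as any two neighbouring positions
lie in an interval at whose ends `g` takes the same value. -/
theorem CyclicallyRegular.isRegularElem_segmentProd {S : Type*} [Semigroup S]
    (hS : CyclicallyRegular S) (g : ℕ → S) {n : ℕ} (hn : 0 < n)
    (h : ∀ i < n, ∃ p k, p ≤ i ∧ i < p + k ∧ p + k ≤ n ∧ g p = g (p + k)) :
    IsRegularElem (segmentProd g 0 n) := by
  have step : ∀ i < n, ∃ j, i < j ∧ j ≤ n ∧ IsRegularElem (segmentProd g 0 j) := by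
    intro i
    induction i using Nat.strong_induction_on with
    | h i ih =>
      intro hi
      obtain ⟨p, k, hpi, hik, hkn, hpk⟩ := h i hi
      have hcycle := hS.isRegularElem_segmentProd_of_eq g (by omega) hpk
      obtain _ | p := p
      · exact ⟨k, by omega, by omega, hcycle⟩
      obtain ⟨j, hij, hjn, hj⟩ := ih p (by omega) (by omega)
      by_cases hjk : p + 1 + k ≤ j
      · exact ⟨j, by omega, hjn, hj⟩
      refine ⟨p + 1 + k, hik, hkn, ?_⟩
      obtain ⟨a, rfl⟩ := Nat.exists_eq_add_of_lt hij
      obtain ⟨b, rfl⟩ : ∃ b, k = a + b + 1 := ⟨k - a - 1, by omega⟩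
      have hprefix := segmentProd_mul_segmentProd g 0 p a
      rw [Nat.zero_add] at hprefix
      rw [← segmentProd_mul_segmentProd] at hcycle
      rw [← hprefix] at hj
      have hwhole := hS.isRegularElem_mul_mul hj hcycle
      have hjoin := segmentProd_mul_segmentProd g 0 (p + a + 1) b
      rw [show 0 + (p + a + 1) + 1 = p + 1 + a + 1 by omega, ← hprefix] at hjoin
      rw [hjoin] at hwhole
      convert hwhole using 2
      omega
  obtain ⟨j, hj, hjn, hreg⟩ := step (n - 1) (by omega)
  rwa [show n = j by omega]

theorem evalWord_take_eq_segmentProd {X S : Type*} [Semigroup S] (f : X → S) (x : X)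
    (w : List X) {k : ℕ} (hk : k ≤ w.length) :
    evalWord f x (w.take k) = segmentProd (fun i => f ((x :: w).getD i x)) 0 k := by
  induction k with
  | zero => simp [evalWord, segmentProd]
  | succ k ih =>
    rw [segmentProd, ← ih (by omega), List.take_succ_eq_append_getElem (by omega)]
    simp only [evalWord, List.foldl_append, List.foldl_cons, List.foldl_nil]
    simp [List.getElem?_eq_getElem (show k < w.length by omega)]

/-- In a cyclically regular semigroup, the value of any regular word under any
assignment of values to its letters is a regular element. -/
theorem stmt_4 {X S : Type*} [Semigroup S] (hS : CyclicallyRegular S)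
    (x : X) (w : List X) (hw : RegularWord (x :: w)) (f : X → S) :
    IsRegularElem (evalWord f x w) := by
  obtain ⟨hlen, hcov⟩ := hw
  rw [List.length_cons] at hlen hcov
  have heval := evalWord_take_eq_segmentProd f x w le_rfl
  rw [List.take_length] at heval
  rw [heval]
  refine hS.isRegularElem_segmentProd _ (by omega) fun i hi => ?_
  obtain ⟨p, q, hpi, hiq, hpq, hq, hends⟩ := hcov i (by omega)
  rw [List.length_cons] at hq
  refine ⟨p, q - 1 - p, hpi, by omega, by omega, ?_⟩
  rw [show p + (q - 1 - p) = q - 1 by omega]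
  simp only [List.getD_eq_getElem?_getD, hends]
end

section
/- A semigroup S is cyclically regular if and only if for every regular word w over any alphabet X and every assignment f : X → S of values to letters, the value of w in S under f is a regular element of S. -/
theorem IsCycleAt.map {X Y : Type*} {u : List X} {p q : ℕ} (h : IsCycleAt u p q) (f : X → Y) :
    IsCycleAt (u.map f) p q := by
  obtain ⟨h₁, h₂, h₃⟩ := h
  exact ⟨h₁, by simpa using h₂, by simp [h₃]⟩

theorem IsCycleAt.append {X : Type*} {u : List X} {p q : ℕ} (h : IsCycleAt u p q) (v : List X) :
    IsCycleAt (u ++ v) p q := by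
  obtain ⟨h₁, h₂, h₃⟩ := h
  refine ⟨h₁, by simp; omega, ?_⟩
  rwa [List.getElem?_append_left (by omega), List.getElem?_append_left (by omega)]

theorem IsCycleAt.exists_drop_eq {X : Type*} {u : List X} {p : ℕ} (h : IsCycleAt u p u.length) :
    ∃ a m, u.drop p = a :: (m ++ [a]) := by
  obtain ⟨h₁, -, h₃⟩ := h
  refine ⟨u[p], (u.drop (p + 1)).dropLast, ?_⟩
  have hne : u.drop (p + 1) ≠ [] := by
    rw [ne_eq, List.drop_eq_nil_iff]
    omega
  rw [List.drop_eq_getElem_cons (by omega)]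
  congr 1
  conv_lhs => rw [← List.dropLast_append_getLast hne]
  congr 2
  rw [List.getLast_drop, List.getLast_eq_getElem]
  rw [List.getElem?_eq_getElem (by omega), List.getElem?_eq_getElem (by omega)] at h₃
  exact (Option.some.inj h₃).symm

/-- The value of a possibly empty word over `S` in the monoid `WithOne S`. -/
def wordProd {S : Type*} [Semigroup S] (u : List S) : WithOne S :=
  (u.map (fun s => (s : WithOne S))).prod

theorem wordProd_append {S : Type*} [Semigroup S] (u v : List S) :
    wordProd (u ++ v) = wordProd u * wordProd v := by
  simp [wordProd]

theorem wordProd_cons {S : Type*} [Semigroup S] (a : S) (u : List S) :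
    wordProd (a :: u) = a * wordProd u := by
  simp [wordProd]

theorem coe_evalWord {X S : Type*} [Semigroup S] (f : X → S) (x : X) (w : List X) :
    ((evalWord f x w : S) : WithOne S) = wordProd ((x :: w).map f) := by
  suffices ∀ s : S, ((w.foldl (fun s c => s * f c) s : S) : WithOne S) =
      s * wordProd (w.map f) by
    rw [List.map_cons, wordProd_cons]
    exact this (f x)
  induction w with
  | nil => simp [wordProd]
  | cons c w ih =>
    intro s
    rw [List.foldl_cons, ih, List.map_cons, wordProd_cons, WithOne.coe_mul, mul_assoc]

theorem isRegularElem_of_coe {S : Type*} [Semigroup S] {b : S} {y : WithOne S}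
    (h : (b : WithOne S) = b * y * b) : IsRegularElem b := by
  cases y with
  | one =>
    have hb : b = b * b := by
      rw [mul_one] at h
      exact_mod_cast h
    exact ⟨b, by rw [← hb, ← hb]⟩
  | coe y => exact ⟨y, by exact_mod_cast h⟩

theorem CyclicallyRegular.exists_wordProd_drop {S : Type*} [Semigroup S]
    (hS : CyclicallyRegular S) {u : List S} {p : ℕ} (h : IsCycleAt u p u.length) :
    ∃ y : S, wordProd (u.drop p) = wordProd (u.drop p) * y * wordProd (u.drop p) := by
  obtain ⟨a, m, hm⟩ := h.exists_drop_eq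
  have key : wordProd (u.drop p) = a * wordProd m * a := by
    rw [hm, wordProd_cons, wordProd_append, mul_assoc]
    simp [wordProd]
  rw [key]
  cases wordProd m with
  | one =>
    obtain ⟨y, hy⟩ := hS.2 a
    exact ⟨y, by rw [mul_one]; exact_mod_cast hy⟩
  | coe x =>
    obtain ⟨y, hy⟩ := hS.1 a x
    exact ⟨y, by exact_mod_cast hy⟩

/-- If the last letters of a word, from position `p` on, form a cycle and the remaining consecutive
pairs are covered by cycles, then the value of the word is regular. The induction step merges the
last cycle with one overlapping it, which replaces the value by an `R`-equivalent one. -/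
theorem CyclicallyRegular.exists_wordProd {S : Type*} [Semigroup S] (hS : CyclicallyRegular S)
    (p : ℕ) (u : List S) (hp : IsCycleAt u p u.length)
    (hu : ∀ i < p, ∃ r q, r ≤ i ∧ i + 1 < q ∧ IsCycleAt u r q) :
    ∃ y : WithOne S, wordProd u = wordProd u * y * wordProd u := by
  induction p using Nat.strong_induction_on generalizing u with
  | _ p ih =>
    obtain ⟨y, hy⟩ := hS.exists_wordProd_drop hp
    rcases Nat.eq_zero_or_pos p with rfl | hpos
    · exact ⟨y, hy⟩
    obtain ⟨r, q, hr, hq, hc⟩ := hu (p - 1) (by omega)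
    obtain hqn | hqn := eq_or_lt_of_le hc.2.1
    · exact ih r (by omega) u (hqn ▸ hc) fun i hi => hu i (by omega)
    set B := (u.drop p).take (q - p) with hB
    have hlen : B.length = q - p := by
      simp only [hB, List.length_take, List.length_drop]
      omega
    obtain ⟨z, hz⟩ := ih r (by omega) (u ++ y :: B) (by
      refine ⟨by simp; omega, le_rfl, ?_⟩
      rw [List.getElem?_append_left (by omega), hc.2.2,
        List.getElem?_append_right (by simp)]
      have h₁ : (u ++ y :: B).length - 1 - u.length = (q - p - 1) + 1 := by
        simp only [List.length_append, List.length_cons]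
        omega
      rw [h₁, List.getElem?_cons_succ, hB, List.getElem?_take_of_lt (by omega),
        List.getElem?_drop]
      congr 1
      omega) fun i hi => by
        obtain ⟨r', q', h₁, h₂, h₃⟩ := hu i (by omega)
        exact ⟨r', q', h₁, h₂, h₃.append _⟩
    have hu' : wordProd u = wordProd (u.take p) * wordProd (u.drop p) := by
      rw [← wordProd_append, List.take_append_drop]
    have hD : wordProd (u.drop p) = wordProd B * wordProd ((u.drop p).drop (q - p)) := by
      rw [← wordProd_append, List.take_append_drop]
    have hv : wordProd (u ++ y :: B) = wordProd u * y * wordProd B := by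
      rw [wordProd_append, wordProd_cons, mul_assoc]
    have hw : wordProd u = wordProd (u ++ y :: B) * wordProd ((u.drop p).drop (q - p)) := by
      rw [hv, mul_assoc _ (wordProd B), ← hD, hu', mul_assoc, mul_assoc,
        ← mul_assoc _ (y : WithOne S), ← hy]
    refine ⟨y * wordProd B * z, ?_⟩
    calc wordProd u
        = wordProd (u ++ y :: B) * z * wordProd (u ++ y :: B) *
            wordProd ((u.drop p).drop (q - p)) := by rw [← hz, ← hw]
      _ = wordProd (u ++ y :: B) * z * wordProd u := by rw [mul_assoc _ (wordProd (u ++ _)), ← hw]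
      _ = wordProd u * (y * wordProd B * z) * wordProd u := by rw [hv]; simp only [mul_assoc]

/-- A semigroup is cyclically regular if and only if the value of every regular
word over any alphabet, under every assignment of values to letters, is a regular
element. -/
theorem stmt_5 {S : Type*} [Semigroup S] :
    CyclicallyRegular S ↔
      ∀ (X : Type) (x : X) (w : List X), RegularWord (x :: w) →
        ∀ f : X → S, IsRegularElem (evalWord f x w) := by
  constructor
  · rintro hS X x w ⟨hl, hw⟩ f
    obtain ⟨p, q, hp, hq, hc⟩ := hw ((x :: w).length - 2) (by omega)
    have hqn : q = (x :: w).length := by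
      have := hc.2.1
      omega
    subst hqn
    obtain ⟨y, hy⟩ := hS.exists_wordProd p ((x :: w).map f)
      (by rw [List.length_map]; exact hc.map f) fun i hi => by
        obtain ⟨r, q, h₁, h₂, h₃⟩ := hw i (by omega)
        exact ⟨r, q, h₁, h₂, h₃.map f⟩
    rw [← coe_evalWord] at hy
    exact isRegularElem_of_coe hy
  · intro h
    refine ⟨fun a x => ?_, fun a => ?_⟩
    · refine h Bool true [false, true] ⟨by simp, fun i hi => ⟨0, 3, by omega, ?_, ?_⟩⟩
        (fun b => cond b a x)
      · simp at hi; omega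
      · simp [IsCycleAt]
    · refine h Unit () [()] ⟨by simp, fun i hi => ⟨0, 2, by omega, ?_, ?_⟩⟩ (fun _ => a)
      · simp at hi; omega
      · simp [IsCycleAt]
end

section
/- Let u be a regular word over an alphabet X and let f : S_X → S_X be any endomorphism of the free semigroup S_X on X (equivalently, a substitution assigning a nonempty word to each letter). Then the image u^f is again a regular word. -/
theorem List.length_flatMap_take_succ {X Y : Type*} (u : List X) (g : X → List Y) {k : ℕ}
    (hk : k < u.length) :
    ((u.take (k + 1)).flatMap g).length = ((u.take k).flatMap g).length + (g u[k]).length := by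
  rw [List.take_succ_eq_append_getElem hk, List.flatMap_append, List.length_append]
  simp

theorem List.length_flatMap_take_mono {X Y : Type*} (u : List X) (g : X → List Y) :
    Monotone fun k => ((u.take k).flatMap g).length :=
  fun _ _ hab => ((List.take_prefix_take_left hab).flatMap g).length_le

theorem List.getElem?_flatMap_length_take_add {X Y : Type*} (u : List X) (g : X → List Y)
    {k r : ℕ} (hk : k < u.length) (hr : r < (g u[k]).length) :
    (u.flatMap g)[((u.take k).flatMap g).length + r]? = (g u[k])[r]? := by
  have hw : u.flatMap g =
      (u.take k).flatMap g ++ (g u[k] ++ (u.drop (k + 1)).flatMap g) := by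
    rw [← List.flatMap_cons, ← List.drop_eq_getElem_cons hk, ← List.flatMap_append,
      List.take_append_drop]
  rw [hw, List.getElem?_append_right (by omega), Nat.add_sub_cancel_left,
    List.getElem?_append_left hr]

/-- The image of a regular word under an endomorphism of the free semigroup,
i.e. under a substitution assigning a nonempty word `g c` to each letter `c`,
is again a regular word. -/
theorem stmt_6 {X : Type*} (u : List X) (hu : RegularWord u)
    (g : X → List X) (hg : ∀ c, g c ≠ []) :
    RegularWord (u.flatMap g) := by
  obtain ⟨hlen, hcyc⟩ := hu
  set P : ℕ → ℕ := fun k => ((u.take k).flatMap g).length with hP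
  have hmono : Monotone P := List.length_flatMap_take_mono u g
  have hpos : ∀ c, 0 < (g c).length := fun c => List.length_pos_of_ne_nil (hg c)
  have hsucc : ∀ k (hk : k < u.length), P (k + 1) = P k + (g u[k]).length :=
    fun k hk => List.length_flatMap_take_succ u g hk
  have hfull : P u.length = (u.flatMap g).length := by simp only [hP, List.take_length]
  have hzero : P 0 = 0 := by simp [hP]
  have hlt : ∀ a b, a < b → b < u.length → P a < P b := fun a b hab hb => by
    have h₁ := hsucc a (by omega)
    have h₂ := hpos u[a]
    have h₃ : P (a + 1) ≤ P b := hmono hab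
    omega
  -- A cycle of `u` whose end letters sit at `a < b` lifts at every offset `r` into their image.
  have hlift : ∀ a b (hab : a < b) (hb : b < u.length), u[a]? = u[b]? →
      ∀ r, r < (g u[b]).length → IsCycleAt (u.flatMap g) (P a + r) (P b + r + 1) := by
    intro a b hab hb he r hr
    have hP_lt := hlt a b hab hb
    have hPb := hsucc b hb
    have hPn : P (b + 1) ≤ P u.length := hmono hb
    have he' : u[a] = u[b] := by
      rwa [List.getElem?_eq_getElem (by omega), List.getElem?_eq_getElem hb,
        Option.some_inj] at he
    refine ⟨by omega, by omega, ?_⟩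
    rw [Nat.add_sub_cancel, List.getElem?_flatMap_length_take_add u g hb hr,
      List.getElem?_flatMap_length_take_add u g (hab.trans hb) (he' ▸ hr), he']
  refine ⟨?_, fun i hi => ?_⟩
  · have h₀ := hlt 0 1 one_pos hlen
    have h₁ := hsucc 1 hlen
    have h₂ := hpos u[1]
    have h₃ : P (1 + 1) ≤ P u.length := hmono hlen
    omega
  · rw [← hfull] at hi
    by_cases hlast : i < P (u.length - 1)
    · have hex : ∃ k, i < P k := ⟨_, hlast⟩
      obtain ⟨j, hj⟩ : ∃ j, Nat.find hex = j + 1 := by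
        refine Nat.exists_eq_succ_of_ne_zero fun h => ?_
        have := Nat.find_spec hex
        rw [h] at this
        omega
      have hij : i < P (j + 1) := hj ▸ Nat.find_spec hex
      have hji : P j ≤ i := not_lt.mp (Nat.find_min hex (by omega))
      have hjn : j + 1 ≤ u.length - 1 := hj ▸ Nat.find_min' hex hlast
      obtain ⟨p, q, hpj, hjq, -, hqn, he⟩ := hcyc j (by omega)
      have h₁ : P p ≤ P j := hmono hpj
      have h₂ : P (j + 1) ≤ P (q - 1) := hmono (by omega)
      exact ⟨_, _, by omega, by omega,
        hlift p (q - 1) (by omega) (by omega) he 0 (hpos _)⟩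
    · obtain ⟨p, q, hpj, hjq, -, hqn, he⟩ := hcyc (u.length - 2) (by omega)
      obtain rfl : q = u.length := by omega
      have h₁ := hlt p (u.length - 1) (by omega) (by omega)
      have h₂ := hsucc (u.length - 1) (by omega)
      rw [Nat.sub_add_cancel (by omega)] at h₂
      exact ⟨_, _, by omega, by omega,
        hlift p (u.length - 1) (by omega) (by omega) he (i + 1 - P (u.length - 1)) (by omega)⟩
end

section
/- Let u be a regular word over an alphabet X and let f : X → A₀ be an assignment of values to letters. If f assigns the value z to some letter occurring in u, then the value of u in A₀ under f equals 0. -/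
/-- The four-element semigroup `A₀ = {a, b, z, 0}` with `a² = a`, `b² = b`,
`a·b = a·z = z·b = z` and all other products equal to `0` (denoted `o`). -/
inductive A0 : Type
  | a | b | z | o
  deriving DecidableEq

namespace A0

def mul : A0 → A0 → A0
  | .a, .a => .a
  | .b, .b => .b
  | .a, .b => .z
  | .a, .z => .z
  | .z, .b => .z
  | _, _ => .o

instance : Mul A0 := ⟨mul⟩

instance : Semigroup A0 where
  mul_assoc x y w := by cases x <;> cases y <;> cases w <;> rfl

end A0

theorem A0.mul_o (s : A0) : s * A0.o = A0.o := by cases s <;> rfl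

theorem foldl_mul_o {X : Type*} (f : X → A0) (w : List X) :
    w.foldl (fun s c => s * f c) A0.o = A0.o := by
  induction w with
  | nil => rfl
  | cons y w ih => exact ih

theorem A0.eq_b_of_mul_ne_o {s t : A0} (h : s * t ≠ A0.o) (hs : s = A0.z ∨ s = A0.b) :
    t = A0.b ∧ (s * t = A0.z ∨ s * t = A0.b) := by
  revert h hs
  cases s <;> cases t <;> decide

theorem A0.eq_a_of_mul_z_ne_o {s : A0} (h : s * A0.z ≠ A0.o) : s = A0.a := by
  revert h
  cases s <;> decide

theorem A0.eq_a_of_mul_eq_a {s t : A0} (h : s * t = A0.a) : s = A0.a := by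
  revert h
  cases s <;> cases t <;> decide

theorem foldl_ne_o {X : Type*} (f : X → A0) (w : List X) (s : A0)
    (h : w.foldl (fun s c => s * f c) s ≠ A0.o) :
    ∀ d ∈ w, (s = A0.z ∨ s = A0.b → f d = A0.b) ∧ (f d = A0.z → s = A0.a) := by
  induction w generalizing s with
  | nil => simp
  | cons y w ih =>
    rw [List.foldl_cons] at h
    have ht : s * f y ≠ A0.o := fun e => h (by rw [e, foldl_mul_o])
    intro d hd
    rcases List.mem_cons.1 hd with rfl | hd
    · exact ⟨fun hs => (A0.eq_b_of_mul_ne_o ht hs).1,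
        fun hz => A0.eq_a_of_mul_z_ne_o (hz ▸ ht)⟩
    · have := ih _ h d hd
      exact ⟨fun hs => this.1 (A0.eq_b_of_mul_ne_o ht hs).2,
        fun hz => A0.eq_a_of_mul_eq_a (this.2 hz)⟩

theorem evalWord_cons {X S : Type*} [Semigroup S] (f : X → S) (x y : X) (w : List X) :
    evalWord f x (y :: w) = f x * evalWord f y w := by
  unfold evalWord
  rw [List.foldl_cons]
  generalize f y = t
  induction w generalizing t with
  | nil => rfl
  | cons c w ih => simp only [List.foldl_cons, mul_assoc, ih]

theorem pairwise_of_evalWord_ne_o {X : Type*} (f : X → A0) (x : X) (w : List X)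
    (h : evalWord f x w ≠ A0.o) :
    (x :: w).Pairwise fun c d => (f c = A0.z → f d = A0.b) ∧ (f d = A0.z → f c = A0.a) := by
  induction w generalizing x with
  | nil => simp
  | cons y w ih =>
    refine List.Pairwise.cons (fun d hd => ?_) (ih y fun e => h ?_)
    · have := foldl_ne_o f (y :: w) (f x) h d hd
      exact ⟨fun hc => this.1 (Or.inl hc), this.2⟩
    · rw [evalWord_cons, e, A0.mul_o]

/-- If a regular word contains a letter whose assigned value in `A₀` is `z`,
then the value of the word in `A₀` is `0`. -/
theorem stmt_10 {X : Type*} (x : X) (w : List X) (hw : RegularWord (x :: w))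
    (f : X → A0) (hz : ∃ c ∈ x :: w, f c = A0.z) :
    evalWord f x w = A0.o := by
  by_contra hne
  have hpair := List.pairwise_iff_getElem.1 (pairwise_of_evalWord_ne_o f x w hne)
  obtain ⟨c, hc, hfc⟩ := hz
  obtain ⟨k, hk, rfl⟩ := List.getElem_of_mem hc
  obtain ⟨hlen, hreg⟩ := hw
  generalize x :: w = u at *
  have after (j : ℕ) (hj : j < u.length) (hkj : k < j) : f u[j] = A0.b :=
    (hpair k j hk hj hkj).1 hfc
  have before (j : ℕ) (hj : j < u.length) (hjk : j < k) : f u[j] = A0.a :=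
    (hpair j k hj hk hjk).2 hfc
  obtain ⟨p, q, hpk, hkq, hpq, hkp⟩ : ∃ p q, p ≤ k ∧ k < q ∧ IsCycleAt u p q ∧
      (p = k → k + 1 < q) := by
    rcases Nat.eq_zero_or_pos k with rfl | hpos
    · obtain ⟨p, q, hp, hq, h⟩ := hreg 0 (by omega)
      exact ⟨p, q, hp, by omega, h, fun _ => hq⟩
    · obtain ⟨p, q, hp, hq, h⟩ := hreg (k - 1) (by omega)
      exact ⟨p, q, by omega, by omega, h, by omega⟩
  obtain ⟨hlt, hq, heq⟩ := hpq
  have hp' : p < u.length := by omega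
  have hq' : q - 1 < u.length := by omega
  rw [List.getElem?_eq_getElem hp', List.getElem?_eq_getElem hq', Option.some_inj] at heq
  have hff := congrArg f heq
  rcases hpk.lt_or_eq with hpk | rfl
  · rw [before p hp' hpk] at hff
    rcases (Nat.le_sub_one_of_lt hkq).lt_or_eq with hkq | rfl
    · rw [after _ hq' hkq] at hff
      cases hff
    · rw [hfc] at hff
      cases hff
  · rw [hfc, after _ hq' (by omega)] at hff
    cases hff
end

section
/- Let n be a positive natural number and let u, v be (possibly empty) words over the two-letter alphabet {x, y}. If a semigroup S satisfies the identity xⁿyⁿ = u·y·x·v (for all values of x, y in S, where u and v are evaluated by the same substitution), then S is regularly closed: the product of any two regular elements of S is regular. -/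
/-- The value in `S¹ = WithOne S` of a possibly empty word over the two-letter
alphabet `{x, y}` (encoded as `List Bool`, `true ↦ X`, `false ↦ Y`): the empty
word evaluates to `1`, i.e. it is omitted from products. -/
def evalW2 {S : Type*} [Semigroup S] (X Y : S) (w : List Bool) : WithOne S :=
  (w.map fun c => ((cond c X Y : S) : WithOne S)).prod

/-- A word in two idempotents `e`, `f` becomes a power of `e * f` when framed by `e` and `f`. -/
lemma IsIdempotentElem.exists_mul_prod_mul_eq_pow {M : Type*} [Monoid M] {e f : M}
    (he : IsIdempotentElem e) (hf : IsIdempotentElem f) (w : List Bool) :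
    (∃ p : ℕ, e * (w.map fun c => cond c e f).prod * f = (e * f) ^ (p + 1)) ∧
      ∃ p : ℕ, f * (w.map fun c => cond c e f).prod * f = f * (e * f) ^ p := by
  induction w with
  | nil => exact ⟨⟨0, by simp⟩, ⟨0, by simp [hf.eq]⟩⟩
  | cons c w ih =>
    obtain ⟨⟨p, hp⟩, ⟨q, hq⟩⟩ := ih
    cases c
    · refine ⟨⟨q, ?_⟩, ⟨q, ?_⟩⟩
      · simp only [List.map_cons, List.prod_cons, cond_false]
        rw [pow_succ', mul_assoc e f ((e * f) ^ q), ← hq]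
        simp only [mul_assoc]
      · simp only [List.map_cons, List.prod_cons, cond_false]
        rw [← mul_assoc f f, hf.eq, hq]
    · refine ⟨⟨p, ?_⟩, ⟨p + 1, ?_⟩⟩
      · simp only [List.map_cons, List.prod_cons, cond_true]
        rw [← mul_assoc e e, he.eq, hp]
      · simp only [List.map_cons, List.prod_cons, cond_true]
        rw [← hp]
        simp only [mul_assoc]

lemma isRegularElem_of_withOne {S : Type*} [Semigroup S] {x : S} {y : WithOne S}
    (h : (x : WithOne S) = x * y * x) : IsRegularElem x := by
  obtain rfl | hy := eq_or_ne y 1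
  · have hx : x = x * x := by
      rw [mul_one] at h
      exact_mod_cast h
    exact ⟨x, by rw [← hx, ← hx]⟩
  · obtain ⟨z, rfl⟩ := WithOne.ne_one_iff_exists.mp hy
    exact ⟨z, by exact_mod_cast h⟩

/-- To show that products of regular elements are regular, it suffices to treat idempotents. -/
lemma IsRegularElem.mul_of_idempotents {S : Type*} [Semigroup S]
    (H : ∀ e f : S, IsIdempotentElem e → IsIdempotentElem f → IsRegularElem (e * f))
    {a b : S} (ha : IsRegularElem a) (hb : IsRegularElem b) : IsRegularElem (a * b) := by
  obtain ⟨a', ha⟩ := ha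
  obtain ⟨b', hb⟩ := hb
  have he : IsIdempotentElem (a' * a) := by
    rw [IsIdempotentElem, mul_assoc, ← mul_assoc a a' a, ← ha]
  have hf : IsIdempotentElem (b * b') := by
    rw [IsIdempotentElem, ← mul_assoc, ← hb]
  obtain ⟨z, hz⟩ := H _ _ he hf
  refine ⟨b' * z * a', ?_⟩
  calc a * b = (a * a' * a) * (b * b' * b) := by rw [← ha, ← hb]
    _ = a * (a' * a * (b * b')) * b := by simp only [mul_assoc]
    _ = a * (a' * a * (b * b') * z * (a' * a * (b * b'))) * b := by rw [← hz]
    _ = (a * a' * a) * b * (b' * z * a') * (a * (b * b' * b)) := by simp only [mul_assoc]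
    _ = a * b * (b' * z * a') * (a * b) := by rw [← ha, ← hb]

/-- If a semigroup satisfies an identity of the form `xⁿyⁿ = u·y·x·v` (with `n`
positive and `u`, `v` possibly empty words over `{x, y}`), then it is regularly
closed: the product of any two regular elements is regular. -/
theorem stmt_13 {S : Type*} [Semigroup S] (n : ℕ) (hn : 0 < n)
    (u v : List Bool)
    (h : ∀ X Y : S, (X : WithOne S) ^ n * (Y : WithOne S) ^ n =
      evalW2 X Y u * (Y : WithOne S) * (X : WithOne S) * evalW2 X Y v) :
    ∀ a b : S, IsRegularElem a → IsRegularElem b → IsRegularElem (a * b) := by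
  intro a b ha hb
  refine ha.mul_of_idempotents (fun e f he hf => ?_) hb
  have hE : IsIdempotentElem (e : WithOne S) := by
    rw [IsIdempotentElem, ← WithOne.coe_mul, he.eq]
  have hF : IsIdempotentElem (f : WithOne S) := by
    rw [IsIdempotentElem, ← WithOne.coe_mul, hf.eq]
  have heval (w : List Bool) :
      evalW2 e f w = (w.map fun c => cond c (e : WithOne S) (f : WithOne S)).prod := by
    unfold evalW2
    congr 2
    funext c
    cases c <;> rfl
  obtain ⟨p, hp⟩ := (hE.exists_mul_prod_mul_eq_pow hF u).1
  obtain ⟨q, hq⟩ := (hE.exists_mul_prod_mul_eq_pow hF v).1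
  have key := h e f
  obtain ⟨m, rfl⟩ := Nat.exists_eq_succ_of_ne_zero hn.ne'
  rw [Nat.succ_eq_add_one, hE.pow_succ_eq, hF.pow_succ_eq, heval, heval] at key
  apply isRegularElem_of_withOne (y := ((e : WithOne S) * (f : WithOne S)) ^ (p + q))
  rw [WithOne.coe_mul]
  calc (e : WithOne S) * f = e * (e * f) * f := by
        rw [← mul_assoc, hE.eq, mul_assoc, hF.eq]
    _ = (e * (u.map fun c => cond c (e : WithOne S) (f : WithOne S)).prod * f) *
          (e * (v.map fun c => cond c (e : WithOne S) (f : WithOne S)).prod * f) := by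
        rw [key]
        simp only [mul_assoc]
    _ = e * f * (e * f) ^ (p + q) * (e * f) := by
        rw [hp, hq, ← pow_add, ← pow_succ', ← pow_succ]
        congr 1
        omega
end

section
/- For every positive natural number n and all (possibly empty) words u, v over the two-letter alphabet {x, y}, the identity xⁿyⁿ = u·y·x·v fails in the semigroup A₀: substituting x ↦ a and y ↦ b, the left-hand side evaluates to z ≠ 0 while the right-hand side evaluates to 0. -/
namespace A0

theorem withOne_mul_zero (x : WithOne A0) : x * (o : WithOne A0) = (o : WithOne A0) := by
  induction x with
  | one => rfl
  | coe s => cases s <;> rfl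

theorem withOne_zero_mul (x : WithOne A0) : (o : WithOne A0) * x = (o : WithOne A0) := by
  induction x with
  | one => rfl
  | coe s => cases s <;> rfl

end A0

/-- Every identity of the form `xⁿyⁿ = u·y·x·v` (with `n` positive and `u`, `v`
possibly empty words over `{x, y}`) fails in `A₀`: substituting `x ↦ a`, `y ↦ b`,
the left-hand side evaluates to `z ≠ 0` while the right-hand side evaluates to `0`. -/
theorem stmt_14 (n : ℕ) (hn : 0 < n) (u v : List Bool) :
    (A0.a : WithOne A0) ^ n * (A0.b : WithOne A0) ^ n = (A0.z : WithOne A0) ∧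
    evalW2 A0.a A0.b u * (A0.b : WithOne A0) * (A0.a : WithOne A0) *
      evalW2 A0.a A0.b v = (A0.o : WithOne A0) ∧
    A0.z ≠ A0.o := by
  have ha : IsIdempotentElem (A0.a : WithOne A0) := rfl
  have hb : IsIdempotentElem (A0.b : WithOne A0) := rfl
  have hba : (A0.b : WithOne A0) * (A0.a : WithOne A0) = (A0.o : WithOne A0) := rfl
  refine ⟨?_, ?_, by decide⟩
  · rw [ha.pow_eq hn.ne', hb.pow_eq hn.ne']
    rfl
  · rw [mul_assoc (evalW2 A0.a A0.b u), hba, A0.withOne_mul_zero, A0.withOne_zero_mul]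
end

section
/- A word u contains no blocking letter if and only if u is covered by cycles. -/
/-- A word is covered by cycles if every occurrence of a letter in it lies
within some cyclic subword. -/
def CoveredByCycles {X : Type*} (u : List X) : Prop :=
  ∀ i, i < u.length → ∃ p q, p ≤ i ∧ i < q ∧ IsCycleAt u p q

/-- A word `u` has a blocking letter if `u = u₁ · t · u₂` where `t` occurs in
neither `u₁` nor `u₂`, and `u₁` and `u₂` have no letters in common. -/
def HasBlockingLetter {X : Type*} (u : List X) : Prop :=
  ∃ (u₁ : List X) (t : X) (u₂ : List X),
    u = u₁ ++ t :: u₂ ∧ t ∉ u₁ ∧ t ∉ u₂ ∧ ∀ c ∈ u₁, c ∉ u₂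

/-- The letter between `u₁` and `u₂` is blocking iff no cycle passes through its position. -/
theorem blocking_iff_not_exists_isCycleAt {X : Type*} (u₁ : List X) (t : X) (u₂ : List X) :
    (t ∉ u₁ ∧ t ∉ u₂ ∧ ∀ c ∈ u₁, c ∉ u₂) ↔
      ¬ ∃ p q, p ≤ u₁.length ∧ u₁.length < q ∧ IsCycleAt (u₁ ++ t :: u₂) p q := by
  have left (a : ℕ) (ha : a < u₁.length) : (u₁ ++ t :: u₂)[a]? = u₁[a]? :=
    List.getElem?_append_left ha
  have mid : (u₁ ++ t :: u₂)[u₁.length]? = some t := by simp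
  have right (b : ℕ) : (u₁ ++ t :: u₂)[u₁.length + 1 + b]? = u₂[b]? := by
    rw [List.getElem?_append_right (by omega), show u₁.length + 1 + b - u₁.length = b + 1 by omega,
      List.getElem?_cons_succ]
  have len : (u₁ ++ t :: u₂).length = u₁.length + 1 + u₂.length := by simp; omega
  constructor
  · rintro ⟨h₁, h₂, h₃⟩ ⟨p, q, hp, hq, hpq, hlen, heq⟩
    rw [len] at hlen
    have hpl : p < u₁.length ∨ p = u₁.length := by omega
    have hql : q - 1 = u₁.length ∨ ∃ b, b < u₂.length ∧ q - 1 = u₁.length + 1 + b := by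
      by_cases h : q - 1 = u₁.length
      · exact .inl h
      · exact .inr ⟨q - 1 - (u₁.length + 1), by omega, by omega⟩
    rcases hpl with hpl | rfl
    · rw [left p hpl, List.getElem?_eq_getElem hpl] at heq
      rcases hql with hql | ⟨b, -, hql⟩
      · rw [hql, mid] at heq
        exact h₁ (Option.some.inj heq ▸ List.getElem_mem hpl)
      · rw [hql, right] at heq
        exact h₃ _ (List.getElem_mem hpl) (List.mem_of_getElem? heq.symm)
    · rcases hql with hql | ⟨b, -, hql⟩
      · omega
      · rw [hql, right, mid] at heq
        exact h₂ (List.mem_of_getElem? heq.symm)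
  · intro h
    refine ⟨fun ht => h ?_, fun ht => h ?_, fun c hc₁ hc₂ => h ?_⟩
    · obtain ⟨a, ha, rfl⟩ := List.getElem_of_mem ht
      refine ⟨a, u₁.length + 1, by omega, by omega, by omega, by omega, ?_⟩
      rw [left a ha, Nat.add_sub_cancel, mid, List.getElem?_eq_getElem ha]
    · obtain ⟨b, hb, hbt⟩ := List.getElem_of_mem ht
      refine ⟨u₁.length, u₁.length + 1 + b + 1, by omega, by omega, by omega, by omega, ?_⟩
      rw [mid, Nat.add_sub_cancel, right, List.getElem?_eq_getElem hb, hbt]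
    · obtain ⟨a, ha, hac⟩ := List.getElem_of_mem hc₁
      obtain ⟨b, hb, hbc⟩ := List.getElem_of_mem hc₂
      refine ⟨a, u₁.length + 1 + b + 1, by omega, by omega, by omega, by omega, ?_⟩
      rw [left a ha, Nat.add_sub_cancel, right, List.getElem?_eq_getElem ha,
        List.getElem?_eq_getElem hb, hac, hbc]

/-- A word contains no blocking letter if and only if it is covered by cycles. -/
theorem stmt_15 {X : Type*} (u : List X) (hu : u ≠ []) :
    ¬ HasBlockingLetter u ↔ CoveredByCycles u := by
  constructor
  · intro h i hi
    by_contra hc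
    have hsplit : u = u.take i ++ u[i] :: u.drop (i + 1) := by simp
    refine h ⟨u.take i, u[i], u.drop (i + 1), hsplit,
      (blocking_iff_not_exists_isCycleAt _ _ _).2 ?_⟩
    rwa [← hsplit, List.length_take_of_le hi.le]
  · rintro h ⟨u₁, t, u₂, rfl, hb⟩
    exact (blocking_iff_not_exists_isCycleAt u₁ t u₂).1 hb (h u₁.length (by simp))
end
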